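/- arXiv:1903.08142 — 11 statements merged into one kernel-verified Lean document; each statement's English description precedes it below -/
import Mathlib

section
/- Let K ≥ 2 be an integer, let t ∈ {1,…,K−1}, and let M be a real number with t ≤ M ≤ t+1. Then the supremum over real λ ≥ 0 of the quantity min_{l ∈ {1,…,K}} ( (K−l)/l + λ(l − M) ) equals ((K−t)/t)(t+1−M) + ((K−t−1)/(t+1))(M−t). -/
/-- Tangent-line bound: the chord of `x ↦ K / x` through the consecutive integers `t` and `t + 1`
lies below `K / l` at every positive integer `l`. -/
lemma chord_le_div_add_mul (K t l : ℕ) (M : ℝ) (ht : 1 ≤ t) (hl : 1 ≤ l) :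
    (((K : ℝ) - t) / t) * ((t : ℝ) + 1 - M)
      + (((K : ℝ) - t - 1) / ((t : ℝ) + 1)) * (M - t)
    ≤ ((K : ℝ) - l) / l + (K : ℝ) / (t * (t + 1)) * ((l : ℝ) - M) := by
  have ht0 : (0 : ℝ) < t := by exact_mod_cast ht
  have hl0 : (0 : ℝ) < l := by exact_mod_cast hl
  have hprod : (0 : ℝ) ≤ ((l : ℝ) - t) * (l - t - 1) := by
    rcases Nat.lt_or_ge t l with h | h
    · have h' : (t : ℝ) + 1 ≤ l := by exact_mod_cast h
      exact mul_nonneg (by linarith) (by linarith)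
    · have h' : (l : ℝ) ≤ t := by exact_mod_cast h
      exact mul_nonneg_of_nonpos_of_nonpos (by linarith) (by linarith)
  have hgap : ((K : ℝ) - l) / l + (K : ℝ) / (t * (t + 1)) * ((l : ℝ) - M)
      - ((((K : ℝ) - t) / t) * ((t : ℝ) + 1 - M)
        + (((K : ℝ) - t - 1) / ((t : ℝ) + 1)) * (M - t))
      = K * (((l : ℝ) - t) * (l - t - 1)) / (l * (t * (t + 1))) := by
    field_simp
    ring
  have hnonneg : (0 : ℝ) ≤ K * (((l : ℝ) - t) * (l - t - 1)) / (l * (t * (t + 1))) := by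
    positivity
  linarith

/-- for integers `K ≥ 2`, `t ∈ {1,…,K−1}` and a real `M` with `t ≤ M ≤ t+1`,
the supremum over reals `λ ≥ 0` of `min_{l ∈ {1,…,K}} ((K−l)/l + λ(l − M))` equals
`((K−t)/t)(t+1−M) + ((K−t−1)/(t+1))(M−t)`. -/
theorem stmt_2 (K : ℕ) (hK : 2 ≤ K) (t : ℕ) (ht1 : 1 ≤ t) (htK : t ≤ K - 1)
    (M : ℝ) (hM1 : (t : ℝ) ≤ M) (hM2 : M ≤ (t : ℝ) + 1) :
    sSup {y : ℝ | ∃ lam : ℝ, 0 ≤ lam ∧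
        y = (Finset.Icc 1 K).inf' ⟨1, Finset.mem_Icc.mpr ⟨le_refl 1, by omega⟩⟩
              (fun l => ((K : ℝ) - l) / l + lam * ((l : ℝ) - M))}
    = (((K : ℝ) - t) / t) * ((t : ℝ) + 1 - M)
      + (((K : ℝ) - t - 1) / ((t : ℝ) + 1)) * (M - t) := by
  have hle : ∀ lam : ℝ,
      (Finset.Icc 1 K).inf' ⟨1, Finset.mem_Icc.mpr ⟨le_refl 1, by omega⟩⟩
          (fun l => ((K : ℝ) - l) / l + lam * ((l : ℝ) - M))
        ≤ (((K : ℝ) - t) / t) * ((t : ℝ) + 1 - M)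
          + (((K : ℝ) - t - 1) / ((t : ℝ) + 1)) * (M - t) := by
    intro lam
    have h₁ := Finset.inf'_le (fun l : ℕ => ((K : ℝ) - l) / l + lam * ((l : ℝ) - M))
      (Finset.mem_Icc.mpr ⟨ht1, by omega⟩ : t ∈ Finset.Icc 1 K)
    have h₂ := Finset.inf'_le (fun l : ℕ => ((K : ℝ) - l) / l + lam * ((l : ℝ) - M))
      (Finset.mem_Icc.mpr ⟨by omega, by omega⟩ : t + 1 ∈ Finset.Icc 1 K)
    push_cast at h₁ h₂
    rw [← sub_sub] at h₂
    have h₁' := mul_le_mul_of_nonneg_right h₁ (by linarith : 0 ≤ (t : ℝ) + 1 - M)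
    have h₂' := mul_le_mul_of_nonneg_right h₂ (by linarith : 0 ≤ M - t)
    linear_combination h₁' + h₂'
  refine IsGreatest.csSup_eq ⟨⟨(K : ℝ) / (t * (t + 1)), by positivity, ?_⟩, ?_⟩
  · refine le_antisymm (Finset.le_inf' _ _ fun l hl => ?_) (hle _)
    exact chord_le_div_add_mul K t l M ht1 (Finset.mem_Icc.mp hl).1
  · rintro y ⟨lam, -, rfl⟩
    exact hle lam
end

section
/- Let K ≥ 2 be an integer, let m_1,…,m_K be nonnegative reals, and let t ∈ {1,…,K−1} satisfy t ≤ m_1+⋯+m_K ≤ t+1. Let x be a fractional uncoded placement for cache sizes m_1,…,m_K. Then Σ_{S} ((K−|S|)/|S|) · x_S ≥ ((K−t)/t)(t+1−Σ_{k=1}^K m_k) + ((K−t−1)/(t+1))(Σ_{k=1}^K m_k − t), where the sum on the left runs over all nonempty subsets S of {1,…,K}. -/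
/-- A fractional uncoded placement for cache sizes `m 1, …, m K`: a family of
nonnegative reals indexed by the nonempty subsets `S` of `{1,…,K}` summing to `1`
and such that the total mass of the sets containing user `k` is at most `m k`. -/
def FracPlacement (K : ℕ) (m : ℕ → ℝ) (x : Finset ℕ → ℝ) : Prop :=
  (∀ S ∈ (Finset.Icc 1 K).powerset.erase ∅, 0 ≤ x S) ∧
  (∑ S ∈ (Finset.Icc 1 K).powerset.erase ∅, x S = 1) ∧
  (∀ k ∈ Finset.Icc 1 K,
    ∑ S ∈ ((Finset.Icc 1 K).powerset.erase ∅).filter (fun S => k ∈ S), x S ≤ m k)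

/-- Double counting: the mass weighted by cardinality is the total mass seen by the points. -/
theorem sum_card_mul_eq_sum_sum_filter {α : Type*} [DecidableEq α] {A : Finset α}
    {F : Finset (Finset α)} (hF : ∀ S ∈ F, S ⊆ A) (x : Finset α → ℝ) :
    ∑ S ∈ F, (S.card : ℝ) * x S = ∑ k ∈ A, ∑ S ∈ F.filter (fun S => k ∈ S), x S := by
  simp_rw [Finset.sum_filter]
  rw [Finset.sum_comm]
  refine Finset.sum_congr rfl fun S hS => ?_
  rw [← Finset.sum_filter, Finset.filter_mem_eq_inter, Finset.inter_eq_right.mpr (hF S hS)]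
  simp

/-- The convex function `s ↦ (K - s) / s` lies, at positive integers, above its chord
through the consecutive integers `t` and `t + 1`. -/
theorem chord_le_sub_div {K : ℝ} (hK : 0 ≤ K) {t s : ℕ} (ht : 0 < t) (hs : 0 < s) :
    (K - t) / t * (t + 1 - s) + (K - t - 1) / (t + 1) * (s - t) ≤ (K - s) / s := by
  have ht' : (0 : ℝ) < t := by exact_mod_cast ht
  have hs' : (0 : ℝ) < s := by exact_mod_cast hs
  have hprod : (0 : ℝ) ≤ (s - t) * (s - t - 1) := by
    rcases le_or_gt s t with h | h
    · have : (s : ℝ) ≤ t := by exact_mod_cast h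
      exact mul_nonneg_of_nonpos_of_nonpos (by linarith) (by linarith)
    · have : (t : ℝ) + 1 ≤ s := by exact_mod_cast h
      exact mul_nonneg (by linarith) (by linarith)
  have hgap : (K - s) / s - ((K - t) / t * (t + 1 - s) + (K - t - 1) / (t + 1) * (s - t))
      = K * ((s - t) * (s - t - 1)) / (s * t * (t + 1)) := by
    field_simp
    ring
  have : 0 ≤ K * ((s - t) * (s - t - 1)) / (s * t * (t + 1)) := by positivity
  linarith

/-- linear-programming converse bound
`Σ_S ((K−|S|)/|S|)·x_S ≥ ((K−t)/t)(t+1−Σ m_k) + ((K−t−1)/(t+1))(Σ m_k − t)`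
for every fractional uncoded placement `x` when `t ≤ Σ m_k ≤ t+1`. -/
theorem stmt_3 (K : ℕ) (hK : 2 ≤ K) (m : ℕ → ℝ) (hm : ∀ k ∈ Finset.Icc 1 K, 0 ≤ m k)
    (t : ℕ) (ht1 : 1 ≤ t) (htK : t ≤ K - 1)
    (hlow : (t : ℝ) ≤ ∑ k ∈ Finset.Icc 1 K, m k)
    (hhigh : ∑ k ∈ Finset.Icc 1 K, m k ≤ (t : ℝ) + 1)
    (x : Finset ℕ → ℝ) (hx : FracPlacement K m x) :
    ∑ S ∈ (Finset.Icc 1 K).powerset.erase ∅, (((K : ℝ) - S.card) / (S.card : ℝ)) * x S ≥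
      (((K : ℝ) - t) / t) * ((t : ℝ) + 1 - ∑ k ∈ Finset.Icc 1 K, m k)
      + (((K : ℝ) - t - 1) / ((t : ℝ) + 1)) * ((∑ k ∈ Finset.Icc 1 K, m k) - t) := by
  obtain ⟨hx0, hx1, hxm⟩ := hx
  have ht : (0 : ℝ) < t := by exact_mod_cast ht1
  have hmass : ∑ S ∈ (Finset.Icc 1 K).powerset.erase ∅, (S.card : ℝ) * x S
      ≤ ∑ k ∈ Finset.Icc 1 K, m k := by
    rw [sum_card_mul_eq_sum_sum_filter (A := Finset.Icc 1 K)
      (fun S hS => Finset.mem_powerset.mp (Finset.mem_of_mem_erase hS))]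
    exact Finset.sum_le_sum hxm
  have hchord : ∀ M : ℝ, ((K : ℝ) - t) / t * (t + 1 - M) + ((K : ℝ) - t - 1) / (t + 1) * (M - t)
      = (K / t + K / (t + 1) - 1) - K / (t * (t + 1)) * M := by
    intro M
    field_simp
    ring
  rw [ge_iff_le, hchord]
  calc (K / t + K / (t + 1) - 1 : ℝ) - K / (t * (t + 1)) * ∑ k ∈ Finset.Icc 1 K, m k
      ≤ (K / t + K / (t + 1) - 1) * 1 - K / (t * (t + 1)) *
          ∑ S ∈ (Finset.Icc 1 K).powerset.erase ∅, (S.card : ℝ) * x S := by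
        rw [mul_one]
        gcongr
    _ = ∑ S ∈ (Finset.Icc 1 K).powerset.erase ∅,
          ((K / t + K / (t + 1) - 1) - K / (t * (t + 1)) * (S.card : ℝ)) * x S := by
        rw [← hx1, Finset.mul_sum, Finset.mul_sum, ← Finset.sum_sub_distrib]
        exact Finset.sum_congr rfl fun S _ => by ring
    _ ≤ _ := by
        refine Finset.sum_le_sum fun S hS => mul_le_mul_of_nonneg_right ?_ (hx0 S hS)
        rw [← hchord]
        exact chord_le_sub_div K.cast_nonneg ht1
          (Finset.card_pos.mpr (Finset.nonempty_iff_ne_empty.mpr (Finset.ne_of_mem_erase hS)))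
end

section
/- Let K ≥ 2 and t ∈ {1,…,K} be integers, and let x be a fractional uncoded placement for cache sizes m_1 = ⋯ = m_K = t/K. Then Σ_{S} ((K−|S|)/|S|) · x_S ≥ (K−t)/t, where the sum runs over all nonempty subsets S of {1,…,K}. -/
/-- Double counting: the placement's expected subset size is at most the total cache size. -/
theorem FracPlacement.sum_card_mul_le {K : ℕ} {m : ℕ → ℝ} {x : Finset ℕ → ℝ}
    (hx : FracPlacement K m x) :
    ∑ S ∈ (Finset.Icc 1 K).powerset.erase ∅, (S.card : ℝ) * x S ≤
      ∑ k ∈ Finset.Icc 1 K, m k := by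
  calc ∑ S ∈ (Finset.Icc 1 K).powerset.erase ∅, (S.card : ℝ) * x S
      = ∑ S ∈ (Finset.Icc 1 K).powerset.erase ∅,
          ∑ k ∈ Finset.Icc 1 K, if k ∈ S then x S else 0 := by
        refine Finset.sum_congr rfl fun S hS => ?_
        have hSK : S ⊆ Finset.Icc 1 K :=
          Finset.mem_powerset.1 (Finset.mem_of_mem_erase hS)
        rw [Finset.sum_ite_mem, Finset.inter_eq_right.2 hSK, Finset.sum_const, nsmul_eq_mul]
    _ = ∑ k ∈ Finset.Icc 1 K,
          ∑ S ∈ ((Finset.Icc 1 K).powerset.erase ∅).filter (fun S => k ∈ S), x S := by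
        rw [Finset.sum_comm]
        simp only [Finset.sum_filter]
    _ ≤ ∑ k ∈ Finset.Icc 1 K, m k := Finset.sum_le_sum hx.2.2

/-- The tangent line at `t` lies below the convex function `s ↦ (K - s) / s`. -/
theorem tangent_le_sub_div {K s t : ℝ} (hK : 0 ≤ K) (hs : 0 < s) (ht : 0 < t) :
    (K - t) / t - K / t ^ 2 * (s - t) ≤ (K - s) / s := by
  have h : (K - s) / s - ((K - t) / t - K / t ^ 2 * (s - t)) =
      K * (s - t) ^ 2 / (s * t ^ 2) := by
    field_simp
    ring
  have : 0 ≤ K * (s - t) ^ 2 / (s * t ^ 2) := by positivity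
  linarith

/-- for equal cache sizes `m_k = t/K`, every fractional uncoded placement
satisfies `Σ_S ((K−|S|)/|S|)·x_S ≥ (K−t)/t`. -/
theorem stmt_4 (K : ℕ) (hK : 2 ≤ K) (t : ℕ) (ht1 : 1 ≤ t) (htK : t ≤ K)
    (x : Finset ℕ → ℝ) (hx : FracPlacement K (fun _ => (t : ℝ) / K) x) :
    ∑ S ∈ (Finset.Icc 1 K).powerset.erase ∅, (((K : ℝ) - S.card) / (S.card : ℝ)) * x S ≥
      ((K : ℝ) - t) / t := by
  have hK0 : (0 : ℝ) < K := by exact_mod_cast (by omega : 0 < K)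
  have ht0 : (0 : ℝ) < t := by exact_mod_cast ht1
  have hcard : ∑ S ∈ (Finset.Icc 1 K).powerset.erase ∅, (S.card : ℝ) * x S ≤ t := by
    have h := hx.sum_card_mul_le
    rwa [Finset.sum_const, Nat.card_Icc, Nat.add_sub_cancel, nsmul_eq_mul,
      mul_div_cancel₀ _ hK0.ne'] at h
  calc ((K : ℝ) - t) / t
      ≤ ((K : ℝ) - t) / t - (K : ℝ) / t ^ 2 *
          (∑ S ∈ (Finset.Icc 1 K).powerset.erase ∅, (S.card : ℝ) * x S - t) := by
        have : (K : ℝ) / t ^ 2 *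
            (∑ S ∈ (Finset.Icc 1 K).powerset.erase ∅, (S.card : ℝ) * x S - t) ≤ 0 :=
          mul_nonpos_of_nonneg_of_nonpos (by positivity) (by linarith)
        linarith
    _ = ∑ S ∈ (Finset.Icc 1 K).powerset.erase ∅,
          (((K : ℝ) - t) / t - (K : ℝ) / t ^ 2 * (S.card - t)) * x S := by
        simp only [sub_mul, mul_sub, Finset.sum_sub_distrib, mul_assoc, ← Finset.mul_sum,
          hx.2.1, mul_one]
    _ ≤ ∑ S ∈ (Finset.Icc 1 K).powerset.erase ∅,
          (((K : ℝ) - S.card) / (S.card : ℝ)) * x S := by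
        refine Finset.sum_le_sum fun S hS => ?_
        have hS0 : (0 : ℝ) < S.card := by
          exact_mod_cast Finset.card_pos.2
            (Finset.nonempty_iff_ne_empty.2 (Finset.ne_of_mem_erase hS))
        exact mul_le_mul_of_nonneg_right (tangent_le_sub_div hK0.le hS0 ht0) (hx.1 S hS)
end

section
/- Let K ≥ 3 be an integer, let 0 ≤ m_1 ≤ m_2 ≤ ⋯ ≤ m_K be reals with (K−2)·m_1 ≥ Σ_{k=2}^K m_k − 1, and let t ∈ {1,…,K−1} satisfy t ≤ Σ_{k=1}^K m_k ≤ t+1. Then there exist nonnegative reals η_1,…,η_K, θ_1,…,θ_K such that Σ_{i=1}^K η_i = (t+1−Σ_{i=1}^K m_i)/C(K−1,t−1) and η_k + ((K−t−1)/t)·θ_k = (1+(K−2)m_k − Σ_{i≠k} m_i)/((K−t)·C(K−1,t−1)) for every k ∈ {1,…,K}. -/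
open Finset in
/-- A nonnegative family `a` and a target `b` with `b ≤ d * ∑ a` and `b` nonnegative can be split
as `η k + e * θ k = d * a k` with `∑ η = b`, provided equality holds when `e = 0`. -/
theorem exists_nonneg_split {ι : Type*} (s : Finset ι) (a : ι → ℝ) (ha : ∀ k ∈ s, 0 ≤ a k)
    {b d e : ℝ} (hb : 0 ≤ b) (hbd : b ≤ d * ∑ k ∈ s, a k) (he : 0 ≤ e)
    (he0 : e = 0 → b = d * ∑ k ∈ s, a k) :
    ∃ η θ : ι → ℝ, (∀ k ∈ s, 0 ≤ η k) ∧ (∀ k ∈ s, 0 ≤ θ k) ∧ ∑ k ∈ s, η k = b ∧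
      ∀ k ∈ s, η k + e * θ k = d * a k := by
  have hA : 0 ≤ ∑ k ∈ s, a k := sum_nonneg ha
  rcases hA.eq_or_lt with hA0 | hApos
  · have hz := (sum_eq_zero_iff_of_nonneg ha).1 hA0.symm
    rw [← hA0, mul_zero] at hbd
    refine ⟨0, 0, by simp, by simp, by simp [le_antisymm hbd hb], fun k hk => ?_⟩
    simp [hz k hk]
  · set c := b / ∑ k ∈ s, a k
    have hc : c ≤ d := (div_le_iff₀ hApos).2 hbd
    have hc0 : 0 ≤ c := div_nonneg hb hA
    refine ⟨fun k => c * a k, fun k => (d - c) * a k / e, fun k hk => mul_nonneg hc0 (ha k hk),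
      fun k hk => div_nonneg (mul_nonneg (sub_nonneg.2 hc) (ha k hk)) he, ?_, fun k _ => ?_⟩
    · rw [← mul_sum, div_mul_cancel₀ _ hApos.ne']
    · rcases eq_or_ne e 0 with h | h
      · have : c = d := (div_eq_iff hApos.ne').2 (he0 h)
        simp [h, this]
      · simp only [mul_div_cancel₀ _ h]
        ring

/-- if `0 ≤ m_1 ≤ ⋯ ≤ m_K`, `(K−2)m_1 ≥ Σ_{k=2}^K m_k − 1` and
`t ≤ Σ m_k ≤ t+1` with `t ∈ {1,…,K−1}`, then there exist nonnegative reals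
`η_1,…,η_K, θ_1,…,θ_K` with `Σ η_i = (t+1−Σ m_i)/C(K−1,t−1)` and
`η_k + ((K−t−1)/t)·θ_k = (1+(K−2)m_k − Σ_{i≠k} m_i)/((K−t)·C(K−1,t−1))` for all `k`. -/
theorem stmt_6 (K : ℕ) (hK : 3 ≤ K) (m : ℕ → ℝ) (hm0 : 0 ≤ m 1)
    (hmono : ∀ k ∈ Finset.Icc 1 (K - 1), m k ≤ m (k + 1))
    (hsmall : ((K : ℝ) - 2) * m 1 ≥ (∑ k ∈ Finset.Icc 2 K, m k) - 1)
    (t : ℕ) (ht1 : 1 ≤ t) (htK : t ≤ K - 1)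
    (hlow : (t : ℝ) ≤ ∑ k ∈ Finset.Icc 1 K, m k)
    (hhigh : ∑ k ∈ Finset.Icc 1 K, m k ≤ (t : ℝ) + 1) :
    ∃ η θ : ℕ → ℝ,
      (∀ k ∈ Finset.Icc 1 K, 0 ≤ η k) ∧ (∀ k ∈ Finset.Icc 1 K, 0 ≤ θ k) ∧
      (∑ i ∈ Finset.Icc 1 K, η i
        = ((t : ℝ) + 1 - ∑ i ∈ Finset.Icc 1 K, m i) / (Nat.choose (K - 1) (t - 1) : ℝ)) ∧
      (∀ k ∈ Finset.Icc 1 K,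
        η k + (((K : ℝ) - t - 1) / t) * θ k
          = (1 + ((K : ℝ) - 2) * m k - ∑ i ∈ (Finset.Icc 1 K).erase k, m i)
            / (((K : ℝ) - t) * (Nat.choose (K - 1) (t - 1) : ℝ))) := by
  have hK1 : 1 ≤ K := by omega
  have hKr : (3 : ℝ) ≤ K := by exact_mod_cast hK
  have htr : (1 : ℝ) ≤ t := by exact_mod_cast ht1
  have htK' : (t : ℝ) + 1 ≤ K := by exact_mod_cast (by omega : t + 1 ≤ K)
  have hC : (0 : ℝ) < Nat.choose (K - 1) (t - 1) := by
    exact_mod_cast Nat.choose_pos (by omega)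
  have hm : ∀ k, 1 ≤ k → k ≤ K → m 1 ≤ m k := by
    intro k hk
    induction k, hk using Nat.le_induction with
    | base => exact fun _ => le_rfl
    | succ n hn ih =>
      exact fun h => (ih (by omega)).trans (hmono n (Finset.mem_Icc.2 ⟨hn, by omega⟩))
  have hsplit : ∑ k ∈ Finset.Icc 1 K, m k = m 1 + ∑ k ∈ Finset.Icc 2 K, m k :=
    (Finset.add_sum_Ioc_eq_sum_Icc hK1).symm
  set S := ∑ k ∈ Finset.Icc 1 K, m k with hS
  set C : ℝ := (Nat.choose (K - 1) (t - 1) : ℝ)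
  have ha : ∀ k ∈ Finset.Icc 1 K, 0 ≤ 1 + ((K : ℝ) - 1) * m k - S := by
    intro k hk
    obtain ⟨h1, h2⟩ := Finset.mem_Icc.1 hk
    nlinarith [mul_le_mul_of_nonneg_left (hm k h1 h2) (by linarith : (0 : ℝ) ≤ K - 1)]
  have hsum : ∑ k ∈ Finset.Icc 1 K, (1 + ((K : ℝ) - 1) * m k - S) = K - S := by
    rw [Finset.sum_sub_distrib, Finset.sum_add_distrib, ← Finset.mul_sum, ← hS]
    simp only [Finset.sum_const, Nat.card_Icc, nsmul_eq_mul, Nat.add_sub_cancel]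
    ring
  have hKt : (0 : ℝ) < K - t := by linarith
  obtain ⟨η, θ, hη, hθ, hηsum, hηθ⟩ := exists_nonneg_split (Finset.Icc 1 K)
    (fun k => 1 + ((K : ℝ) - 1) * m k - S) ha
    (b := ((t : ℝ) + 1 - S) / C) (d := 1 / (((K : ℝ) - t) * C)) (e := ((K : ℝ) - t - 1) / t)
    (div_nonneg (by linarith) hC.le)
    (by
      rw [hsum, one_div_mul_eq_div, ← div_div]
      gcongr
      rw [le_div_iff₀ hKt]
      nlinarith [mul_nonneg (sub_nonneg.2 hlow) (by linarith : (0 : ℝ) ≤ K - t - 1)])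
    (div_nonneg (by linarith) (by linarith))
    (by
      intro h
      have h' : (K : ℝ) - t = 1 := by
        rcases div_eq_zero_iff.1 h with h | h <;> linarith
      rw [hsum, h', one_mul, one_div_mul_eq_div]
      congr 1
      linarith)
  refine ⟨η, θ, hη, hθ, hηsum, fun k hk => ?_⟩
  rw [hηθ k hk, one_div_mul_eq_div, Finset.sum_erase_eq_sub hk, ← hS]
  ring
end

section
/- Let K ≥ 2 be an integer, t ∈ {1,…,K−1}, and let m_1,…,m_K, η_1,…,η_K, θ_1,…,θ_K be real numbers satisfying Σ_{i=1}^K η_i = (t+1−Σ_{i=1}^K m_i)/C(K−1,t−1) and η_k + ((K−t−1)/t)·θ_k = (1+(K−2)m_k − Σ_{i≠k} m_i)/((K−t)·C(K−1,t−1)) for every k ∈ {1,…,K}. Then C(K−1,t)·Σ_{j=1}^K η_j + C(K−1,t+1)·Σ_{j=1}^K θ_j = ((K−t)/t)·(t+1−Σ_{k=1}^K m_k) + ((K−t−1)/(t+1))·(Σ_{k=1}^K m_k − t). -/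
/-- if `Σ η_i = (t+1−Σ m_i)/C(K−1,t−1)` and
`η_k + ((K−t−1)/t)·θ_k = (1+(K−2)m_k − Σ_{i≠k} m_i)/((K−t)·C(K−1,t−1))` for all `k`,
then `C(K−1,t)·Σ η_j + C(K−1,t+1)·Σ θ_j
  = ((K−t)/t)(t+1−Σ m_k) + ((K−t−1)/(t+1))(Σ m_k − t)`. -/
theorem stmt_7 (K : ℕ) (hK : 2 ≤ K) (t : ℕ) (ht1 : 1 ≤ t) (htK : t ≤ K - 1)
    (m η θ : ℕ → ℝ)
    (h1 : ∑ i ∈ Finset.Icc 1 K, η i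
      = ((t : ℝ) + 1 - ∑ i ∈ Finset.Icc 1 K, m i) / (Nat.choose (K - 1) (t - 1) : ℝ))
    (h2 : ∀ k ∈ Finset.Icc 1 K,
      η k + (((K : ℝ) - t - 1) / t) * θ k
        = (1 + ((K : ℝ) - 2) * m k - ∑ i ∈ (Finset.Icc 1 K).erase k, m i)
          / (((K : ℝ) - t) * (Nat.choose (K - 1) (t - 1) : ℝ))) :
    (Nat.choose (K - 1) t : ℝ) * (∑ j ∈ Finset.Icc 1 K, η j)
      + (Nat.choose (K - 1) (t + 1) : ℝ) * (∑ j ∈ Finset.Icc 1 K, θ j)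
    = (((K : ℝ) - t) / t) * ((t : ℝ) + 1 - ∑ k ∈ Finset.Icc 1 K, m k)
      + (((K : ℝ) - t - 1) / ((t : ℝ) + 1)) * ((∑ k ∈ Finset.Icc 1 K, m k) - t) := by
  have hC : 0 < (Nat.choose (K - 1) (t - 1) : ℝ) := by
    exact_mod_cast Nat.choose_pos (by omega)
  have ht : (0 : ℝ) < t := by exact_mod_cast ht1
  have ht' : (t : ℝ) + 1 ≠ 0 := by positivity
  have hKt : (0 : ℝ) < (K : ℝ) - t := by
    rw [sub_pos]
    exact_mod_cast (by omega : t < K)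
  have hA : (Nat.choose (K - 1) t : ℝ) * t
      = (Nat.choose (K - 1) (t - 1) : ℝ) * ((K : ℝ) - t) := by
    have h := Nat.choose_succ_right_eq (K - 1) (t - 1)
    rw [Nat.sub_add_cancel ht1, (by omega : K - 1 - (t - 1) = K - t)] at h
    rw [← Nat.cast_sub (by omega : t ≤ K)]
    exact_mod_cast h
  have hB : (Nat.choose (K - 1) (t + 1) : ℝ) * ((t : ℝ) + 1)
      = (Nat.choose (K - 1) t : ℝ) * ((K : ℝ) - t - 1) := by
    have h := Nat.choose_succ_right_eq (K - 1) t
    have e : (K : ℝ) - t - 1 = ((K - 1 - t : ℕ) : ℝ) := by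
      rw [Nat.cast_sub htK, Nat.cast_sub (by omega : 1 ≤ K)]
      push_cast
      ring
    rw [e]
    exact_mod_cast h
  have hS := Finset.sum_congr rfl h2
  rw [Finset.sum_add_distrib, ← Finset.mul_sum, ← Finset.sum_div] at hS
  have hN : ∑ k ∈ Finset.Icc 1 K,
      (1 + ((K : ℝ) - 2) * m k - ∑ i ∈ (Finset.Icc 1 K).erase k, m i)
      = (K : ℝ) - ∑ k ∈ Finset.Icc 1 K, m k := by
    have h : ∀ k ∈ Finset.Icc 1 K,
        1 + ((K : ℝ) - 2) * m k - ∑ i ∈ (Finset.Icc 1 K).erase k, m i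
        = (1 - ∑ i ∈ Finset.Icc 1 K, m i) + ((K : ℝ) - 1) * m k := by
      intro k hk
      rw [← Finset.add_sum_erase _ m hk]
      ring
    rw [Finset.sum_congr rfl h, Finset.sum_add_distrib, ← Finset.mul_sum]
    simp only [Finset.sum_const, Nat.card_Icc, Nat.add_sub_cancel, nsmul_eq_mul]
    ring
  rw [hN] at hS
  generalize ∑ k ∈ Finset.Icc 1 K, m k = M at *
  generalize ∑ k ∈ Finset.Icc 1 K, η k = E at *
  generalize ∑ k ∈ Finset.Icc 1 K, θ k = T at *
  rw [← eq_div_iff ht.ne'] at hA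
  rw [← eq_div_iff ht', hA] at hB
  rw [hB, hA]
  generalize (Nat.choose (K - 1) (t - 1) : ℝ) = C at *
  have hT : ((K : ℝ) - t - 1) / t * T
      = ((K : ℝ) - M) / (((K : ℝ) - t) * C) - ((t : ℝ) + 1 - M) / C := by
    rw [← hS, h1]
    ring
  calc C * ((K : ℝ) - t) / t * E + C * ((K : ℝ) - t) / t * ((K : ℝ) - t - 1) / ((t : ℝ) + 1) * T
      = C * ((K : ℝ) - t) / t * E
        + C * ((K : ℝ) - t) / ((t : ℝ) + 1) * (((K : ℝ) - t - 1) / t * T) := by ring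
    _ = _ := by
      rw [hT, h1]
      have := hKt.ne'
      field_simp
      ring
end

section
/- Let K ≥ 3 be an integer, l ∈ {1,…,K−2}, and let 0 ≤ m_1 ≤ ⋯ ≤ m_K be reals with 1 ≤ Σ_{k=1}^K m_k ≤ 2, (K−l−1)·m_l < Σ_{i=l+1}^K m_i − 1, and (K−l−2)·m_{l+1} ≥ Σ_{i=l+2}^K m_i − 1. Then there exist nonnegative reals a_{{j}} for j ∈ {l+1,…,K}, a_{{i,j}} for i ∈ {1,…,l} and j ∈ {l+1,…,K}, and a_{{i,j}} for two-element subsets {i,j} ⊆ {l+1,…,K}, such that: (i) Σ_{j=l+1}^K a_{{j}} = 2 − Σ_{k=1}^K m_k; (ii) Σ_{{i,j} ⊆ {l+1,…,K}} a_{{i,j}} = Σ_{i=l+1}^K m_i − 1; (iii) Σ_{j=l+1}^K a_{{i,j}} = m_i for every i ∈ {1,…,l}; (iv) a_{{j}} + Σ_{S : |S|=2, j ∈ S} a_S = m_j for every j ∈ {l+1,…,K}; (v) a_{{i_1,j}} ≤ a_{{i_2,j}} whenever i_1 < i_2 ≤ l and j ∈ {l+1,…,K}; and (vi) a_{{l,i}}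 + a_{{l,j}} ≤ a_{{i,j}} for every two-element subset {i,j} ⊆ {l+1,…,K}. -/
/-- Length of the overlap of the intervals `[a, b]` and `[c, e]`, for `a ≤ b` and `c ≤ e`. -/
def intervalOverlap (a b c e : ℝ) : ℝ := max a (min b e) - max a (min b c)

theorem intervalOverlap_nonneg {a b c e : ℝ} (h : c ≤ e) : 0 ≤ intervalOverlap a b c e :=
  sub_nonneg.2 (max_le_max le_rfl (min_le_min le_rfl h))

theorem intervalOverlap_comm {a b c e : ℝ} (hab : a ≤ b) (hce : c ≤ e) :
    intervalOverlap a b c e = intervalOverlap c e a b := by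
  unfold intervalOverlap
  grind

theorem intervalOverlap_add_right (a b c e t : ℝ) :
    intervalOverlap (a + t) (b + t) c e = intervalOverlap a b (c - t) (e - t) := by
  unfold intervalOverlap
  grind

theorem sum_Ico_intervalOverlap (a b : ℝ) (D : ℕ → ℝ) {p N : ℕ} (h : p ≤ N) :
    ∑ j ∈ Finset.Ico p N, intervalOverlap a b (D j) (D (j + 1))
      = intervalOverlap a b (D p) (D N) := by
  induction N, h using Nat.le_induction with
  | base => simp [intervalOverlap]
  | succ k hk ih =>
    rw [Finset.sum_Ico_succ_top hk, ih]
    unfold intervalOverlap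
    ring

/-- A nonnegative sequence with sum `2 * Q`, all of whose terms are at most `Q`, is the sequence of
weighted degrees of a loopless graph with nonnegative edge weights: lay the terms out as consecutive
arcs on a circle of circumference `2 * Q` and match antipodal points. -/
theorem exists_edge_weights {p N : ℕ} (h : p ≤ N) (d : ℕ → ℝ) (Q : ℝ) (hd : ∀ j, 0 ≤ d j)
    (hsum : ∑ j ∈ Finset.Ico p N, d j = 2 * Q) (hQ : ∀ j ∈ Finset.Ico p N, d j ≤ Q) :
    ∃ q : ℕ → ℕ → ℝ, (∀ i j, q i j = q j i) ∧ (∀ i j, 0 ≤ q i j) ∧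
      ∀ j ∈ Finset.Ico p N, ∑ i ∈ (Finset.Ico p N).erase j, q i j = d j := by
  set D : ℕ → ℝ := fun k => ∑ i ∈ Finset.Ico p k, d i with hD
  have hmono : Monotone D := fun a b hab =>
    Finset.sum_le_sum_of_subset_of_nonneg (Finset.Ico_subset_Ico le_rfl hab) fun i _ _ => hd i
  have hstep : ∀ k, D k ≤ D (k + 1) := fun k => hmono k.le_succ
  have hsucc : ∀ j ∈ Finset.Ico p N, D (j + 1) = D j + d j := fun j hj =>
    Finset.sum_Ico_succ_top (Finset.mem_Ico.1 hj).1 d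
  have hDp : D p = 0 := by simp [hD]
  have hDN : D N = 2 * Q := hsum
  set q : ℕ → ℕ → ℝ := fun i j =>
    intervalOverlap (D j + Q) (D (j + 1) + Q) (D i) (D (i + 1)) +
      intervalOverlap (D j + -Q) (D (j + 1) + -Q) (D i) (D (i + 1)) with hq
  refine ⟨q, fun i j => ?_, fun i j => ?_, fun j hj => ?_⟩
  · have hi := hstep i
    have hj := hstep j
    simp only [hq, intervalOverlap_add_right (D j)]
    rw [intervalOverlap_comm hj (by linarith), intervalOverlap_comm hj (by linarith)]
    simp only [sub_eq_add_neg, neg_neg]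
    ring
  · exact add_nonneg (intervalOverlap_nonneg (hstep i)) (intervalOverlap_nonneg (hstep i))
  · have hdj := hsucc j hj
    have hdQ := hQ j hj
    have hd0 := hd j
    have hj' := Finset.mem_Ico.1 hj
    have hloop : q j j = 0 := by
      simp only [hq, intervalOverlap, hdj]
      grind
    have h0 : 0 ≤ D j := hDp ▸ hmono hj'.1
    have h1 : D (j + 1) ≤ 2 * Q := hDN ▸ hmono hj'.2
    rw [Finset.sum_erase (f := fun i => q i j) _ hloop]
    simp only [hq, Finset.sum_add_distrib, sum_Ico_intervalOverlap _ _ D h, hDp, hDN]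
    rw [hdj] at h1 ⊢
    unfold intervalOverlap
    grind

theorem two_mul_le_sum_min {ι : Type*} [DecidableEq ι] (J : Finset ι) (N : ι → ℝ) (c Q : ℝ)
    (hcard : 2 ≤ J.card) (hQ : 0 ≤ Q) (hc : ∀ j ∈ J, c ≤ N j) (hcQ : Q ≤ ((J.card : ℝ) - 1) * c)
    (hsum : 2 * Q ≤ ∑ j ∈ J, N j) : 2 * Q ≤ ∑ j ∈ J, min Q (N j) := by
  by_cases hk : ∃ k ∈ J, Q ≤ N k
  · obtain ⟨k, hkJ, hk⟩ := hk
    rw [← Finset.add_sum_erase J _ hkJ, min_eq_left hk]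
    have h1 : (J.erase k).card • min Q c ≤ ∑ j ∈ J.erase k, min Q (N j) :=
      Finset.card_nsmul_le_sum _ _ _ fun j hj =>
        min_le_min le_rfl (hc j (Finset.mem_of_mem_erase hj))
    rw [Finset.card_erase_of_mem hkJ, nsmul_eq_mul, Nat.cast_sub (by omega), Nat.cast_one] at h1
    have h2 : (2 : ℝ) ≤ J.card := by exact_mod_cast hcard
    have h3 : Q ≤ ((J.card : ℝ) - 1) * min Q c := by
      rcases min_choice Q c with h | h <;> rw [h]
      · nlinarith
      · exact hcQ
    linarith
  · push Not at hk
    rwa [Finset.sum_congr rfl fun j hj => min_eq_right (hk j hj).le]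

theorem exists_weights {ι : Type*} (J : Finset ι) (hJ : J.Nonempty) (t : ι → ℝ) (R : ℝ)
    (ht : ∀ j ∈ J, 0 ≤ t j) (hsum : ∑ j ∈ J, t j = R) :
    ∃ w : ι → ℝ, (∀ j ∈ J, 0 ≤ w j) ∧ ∑ j ∈ J, w j = 1 ∧ ∀ j ∈ J, R * w j = t j := by
  have hR : 0 ≤ R := hsum ▸ Finset.sum_nonneg ht
  rcases hR.eq_or_lt with h | h
  · refine ⟨fun _ => (J.card : ℝ)⁻¹, fun _ _ => by positivity, ?_, fun j hj => ?_⟩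
    · have : (J.card : ℝ) ≠ 0 := by exact_mod_cast hJ.card_pos.ne'
      simp [this]
    · rw [(Finset.sum_eq_zero_iff_of_nonneg ht).1 (hsum.trans h.symm) j hj, ← h, zero_mul]
  · refine ⟨fun j => t j / R, fun j hj => div_nonneg (ht j hj) h.le, ?_, fun j _ => ?_⟩
    · rw [← Finset.sum_div, hsum, div_self h.ne']
    · field_simp

theorem sum_powerset_filter_pair_mem {ι : Type*} [DecidableEq ι] (V : Finset ι) (a : Finset ι → ℝ)
    {j : ι} (hj : j ∈ V) :
    ∑ S ∈ V.powerset.filter (fun S => S.card = 2 ∧ j ∈ S), a S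
      = ∑ i ∈ V.erase j, a {i, j} := by
  symm
  refine Finset.sum_bij (fun i _ => {i, j}) (fun i hi => ?_) (fun i hi k hk h => ?_)
    (fun S hS => ?_) fun _ _ => rfl
  · obtain ⟨hij, hi⟩ := Finset.mem_erase.1 hi
    simp [Finset.insert_subset_iff, hi, hj, Finset.card_pair hij]
  · have hij := (Finset.mem_erase.1 hi).1
    have : i ∈ ({k, j} : Finset ι) := h ▸ Finset.mem_insert_self i {j}
    simpa [hij] using this
  · simp only [Finset.mem_filter, Finset.mem_powerset] at hS
    obtain ⟨hSV, hcard, hjS⟩ := hS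
    have h1 : (S.erase j).card = 1 := by rw [Finset.card_erase_of_mem hjS, hcard]
    obtain ⟨i, hi⟩ := Finset.card_eq_one.1 h1
    have hiS : i ∈ S.erase j := hi ▸ Finset.mem_singleton_self i
    refine ⟨i, Finset.erase_subset_erase _ hSV hiS, ?_⟩
    rw [← Finset.insert_erase hjS, hi, Finset.pair_comm]

theorem sum_sum_powerset_filter_pair_mem {ι : Type*} [DecidableEq ι] (V : Finset ι)
    (a : Finset ι → ℝ) :
    ∑ j ∈ V, ∑ S ∈ V.powerset.filter (fun S => S.card = 2 ∧ j ∈ S), a S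
      = 2 * ∑ S ∈ V.powerset.filter (fun S => S.card = 2), a S := by
  simp only [← Finset.filter_filter]
  simp only [Finset.sum_filter (p := fun S => _ ∈ S)]
  rw [Finset.sum_comm, Finset.mul_sum]
  refine Finset.sum_congr rfl fun S hS => ?_
  simp only [Finset.mem_filter, Finset.mem_powerset] at hS
  rw [← Finset.sum_filter, Finset.filter_mem_eq_inter, Finset.inter_eq_right.2 hS.1,
    Finset.sum_const, hS.2, nsmul_eq_mul, Nat.cast_ofNat]

/-- Values on singletons and symmetric values on pairs extend to a function on finsets. -/
theorem exists_finset_function {ι : Type*} [DecidableEq ι] (s : ι → ℝ) (G : ι → ι → ℝ)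
    (hG : ∀ i j, G i j = G j i) :
    ∃ a : Finset ι → ℝ, (∀ j, a {j} = s j) ∧ ∀ i j, i ≠ j → a {i, j} = G i j := by
  refine ⟨fun S => if S.card = 1 then ∑ j ∈ S, s j else (∑ p ∈ S.offDiag, G p.1 p.2) / 2,
    fun j => by simp, fun i j hij => ?_⟩
  have hoff : ({i, j} : Finset ι).offDiag = {(i, j), (j, i)} := by
    ext ⟨x, y⟩
    simp only [Finset.mem_offDiag, Finset.mem_insert, Finset.mem_singleton, Prod.mk.injEq]
    grind
  have hne : (i, j) ≠ (j, i) := fun h => hij (Prod.mk.inj h).1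
  simp only [Finset.card_pair hij, hoff, Finset.sum_pair hne, hG j i]
  norm_num


/-- feasibility of the uncoded placement in the small total-memory regime
at heterogeneity level `l`.  The allocation `a` is a real value for each subset of users
(only singletons `{j}` with `j > l`, pairs `{i,j}` with `i ≤ l < j`, and pairs inside
`{l+1,…,K}` are constrained). -/
theorem stmt_8 (K : ℕ) (hK : 3 ≤ K) (l : ℕ) (hl1 : 1 ≤ l) (hlK : l ≤ K - 2)
    (m : ℕ → ℝ) (hm0 : 0 ≤ m 1)
    (hmono : ∀ k ∈ Finset.Icc 1 (K - 1), m k ≤ m (k + 1))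
    (hlow : 1 ≤ ∑ k ∈ Finset.Icc 1 K, m k) (hhigh : ∑ k ∈ Finset.Icc 1 K, m k ≤ 2)
    (hstrict : ((K : ℝ) - l - 1) * m l < (∑ i ∈ Finset.Icc (l + 1) K, m i) - 1)
    (hge : ((K : ℝ) - l - 2) * m (l + 1) ≥ (∑ i ∈ Finset.Icc (l + 2) K, m i) - 1) :
    ∃ a : Finset ℕ → ℝ,
      (∀ j ∈ Finset.Icc (l + 1) K, 0 ≤ a {j}) ∧
      (∀ i ∈ Finset.Icc 1 l, ∀ j ∈ Finset.Icc (l + 1) K, 0 ≤ a {i, j}) ∧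
      (∀ S ∈ (Finset.Icc (l + 1) K).powerset.filter (fun S => S.card = 2), 0 ≤ a S) ∧
      -- (i)
      (∑ j ∈ Finset.Icc (l + 1) K, a {j} = 2 - ∑ k ∈ Finset.Icc 1 K, m k) ∧
      -- (ii)
      (∑ S ∈ (Finset.Icc (l + 1) K).powerset.filter (fun S => S.card = 2), a S
        = (∑ i ∈ Finset.Icc (l + 1) K, m i) - 1) ∧
      -- (iii)
      (∀ i ∈ Finset.Icc 1 l, ∑ j ∈ Finset.Icc (l + 1) K, a {i, j} = m i) ∧
      -- (iv)
      (∀ j ∈ Finset.Icc (l + 1) K,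
        a {j} + ∑ S ∈ (Finset.Icc 1 K).powerset.filter (fun S => S.card = 2 ∧ j ∈ S), a S
          = m j) ∧
      -- (v)
      (∀ i₁ ∈ Finset.Icc 1 l, ∀ i₂ ∈ Finset.Icc 1 l, i₁ < i₂ →
        ∀ j ∈ Finset.Icc (l + 1) K, a {i₁, j} ≤ a {i₂, j}) ∧
      -- (vi)
      (∀ i ∈ Finset.Icc (l + 1) K, ∀ j ∈ Finset.Icc (l + 1) K, i ≠ j →
        a {l, i} + a {l, j} ≤ a {i, j}) := by
  set J := Finset.Icc (l + 1) K with hJ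
  set I := Finset.Icc 1 l with hI
  have hmem : ∀ {j}, j ∈ J ↔ l + 1 ≤ j ∧ j ≤ K := Finset.mem_Icc
  have hJcard : J.card = K - l := by simp [hJ]
  have hJcast : (J.card : ℝ) = (K : ℝ) - l := by rw [hJcard, Nat.cast_sub (by omega)]
  have hn : (2 : ℝ) ≤ J.card := by exact_mod_cast (by omega : 2 ≤ J.card)
  have hmle : ∀ i j, 1 ≤ i → i ≤ j → j ≤ K → m i ≤ m j := by
    intro i j hi hij
    induction j, hij using Nat.le_induction with
    | base => exact fun _ => le_rfl
    | succ k hk ih =>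
      exact fun hkK => (ih (by omega)).trans (hmono k (Finset.mem_Icc.2 ⟨by omega, by omega⟩))
  have hmnn : ∀ i, 1 ≤ i → i ≤ K → 0 ≤ m i := fun i hi hiK => hm0.trans (hmle 1 i le_rfl hi hiK)
  have hdisj : Disjoint I J := by
    rw [Finset.disjoint_left]
    intro x hx hx'
    simp only [hI, hJ, Finset.mem_Icc] at hx hx'
    omega
  have hunion : Finset.Icc 1 K = I ∪ J := by
    ext x
    simp only [hI, hJ, Finset.mem_union, Finset.mem_Icc]
    omega
  have hsplit : ∑ k ∈ Finset.Icc 1 K, m k = ∑ k ∈ I, m k + ∑ k ∈ J, m k := by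
    rw [hunion, Finset.sum_union hdisj]
  have hfirst : ∑ k ∈ J, m k = m (l + 1) + ∑ k ∈ Finset.Icc (l + 2) K, m k := by
    rw [hJ, ← Finset.insert_Icc_add_one_left_eq_Icc (by omega : l + 1 ≤ K),
      Finset.sum_insert (by simp), add_assoc l 1 1]
  rw [hsplit] at hlow hhigh
  simp only [hsplit]
  set X := ∑ k ∈ I, m k with hX
  set T := ∑ k ∈ J, m k - 1 with hT
  set n : ℝ := (J.card : ℝ) with hnd
  have hlX : m l ≤ X :=
    Finset.single_le_sum (fun i hi => hmnn i (Finset.mem_Icc.1 hi).1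
      ((Finset.mem_Icc.1 hi).2.trans (by omega))) (Finset.mem_Icc.2 ⟨hl1, le_rfl⟩)
  have hl0 : 0 ≤ m l := hmnn l hl1 (by omega)
  have hn2 : 0 ≤ (n - 2) * m l := mul_nonneg (by linarith) hl0
  set Q := T - (n - 1) * m l with hQ
  have hQpos : 0 < Q := by
    rw [hQ, hJcast]
    linarith
  have hN0 : ∀ j ∈ J, 0 ≤ m j - m l := fun j hj =>
    sub_nonneg.2 (hmle l j hl1 (by have := hmem.1 hj; omega) (hmem.1 hj).2)
  have hNsum : ∑ j ∈ J, (m j - m l) = T + 1 - n * m l := by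
    rw [Finset.sum_sub_distrib, Finset.sum_const, nsmul_eq_mul]
    ring
  have hmin : 2 * Q ≤ ∑ j ∈ J, min Q (m j - m l) := by
    refine two_mul_le_sum_min J _ (m (l + 1) - m l) Q (by omega) hQpos.le (fun j hj => ?_) ?_ ?_
    · exact sub_le_sub_right (hmle _ _ (by omega) (hmem.1 hj).1 (hmem.1 hj).2) _
    · rw [← hnd, hJcast, hQ, hJcast]
      linarith
    · rw [hNsum]
      linarith
  set W := ∑ j ∈ J, min Q (m j - m l) with hW
  have hWpos : 0 < W := by linarith
  set d : ℕ → ℝ := fun j => if j ∈ J then 2 * Q / W * min Q (m j - m l) else 0 with hd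
  have hratio : 2 * Q / W ≤ 1 := (div_le_one hWpos).2 hmin
  have hratio0 : 0 ≤ 2 * Q / W := by positivity
  have hminnn : ∀ j ∈ J, 0 ≤ min Q (m j - m l) := fun j hj => le_min hQpos.le (hN0 j hj)
  have hdle : ∀ j ∈ J, d j ≤ min Q (m j - m l) := fun j hj => by
    simp only [hd, if_pos hj]
    exact mul_le_of_le_one_left (hminnn j hj) hratio
  have hdsum : ∑ j ∈ J, d j = 2 * Q := by
    rw [Finset.sum_congr rfl fun j hj => if_pos hj, ← Finset.mul_sum, ← hW]
    field_simp
  have hJIco : J = Finset.Ico (l + 1) (K + 1) := by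
    ext x
    simp only [hJ, Finset.mem_Icc, Finset.mem_Ico]
    omega
  obtain ⟨q, hqsymm, hqnn, hqdeg⟩ := exists_edge_weights (by omega : l + 1 ≤ K + 1) d Q
    (fun j => by
      by_cases hj : j ∈ J
      · simpa only [hd, if_pos hj] using mul_nonneg hratio0 (hminnn j hj)
      · simp only [hd, if_neg hj, le_refl])
    (hJIco ▸ hdsum) (hJIco ▸ fun j hj => (hdle j hj).trans (min_le_left _ _))
  rw [← hJIco] at hqdeg
  obtain ⟨w, hw0, hw1, hw⟩ := exists_weights J (Finset.card_pos.1 (by omega))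
    (fun j => m j - m l - d j) (1 - T + (n - 2) * m l)
    (fun j hj => sub_nonneg.2 ((hdle j hj).trans (min_le_right _ _)))
    (by rw [Finset.sum_sub_distrib, hNsum, hdsum, hQ]; ring)
  set G : ℕ → ℕ → ℝ := fun i j =>
    if i ≤ l then (if j ≤ l then 0 else m i * w j)
    else if j ≤ l then m j * w i else m l * w i + m l * w j + q i j with hG
  obtain ⟨a, ha1, ha2⟩ := exists_finset_function (fun j => (1 - T - X) * w j) G (fun i j => by
    by_cases hi : i ≤ l <;> by_cases hj : j ≤ l <;> simp only [hG, hi, hj, if_true, if_false]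
    rw [hqsymm i j]
    ring)
  have hIJ : ∀ i ∈ I, ∀ j ∈ J, a {i, j} = m i * w j := fun i hi j hj => by
    have h1 := (Finset.mem_Icc.1 hi).2
    have h2 := (hmem.1 hj).1
    rw [ha2 i j (by omega)]
    simp only [hG, if_pos h1, if_neg (by omega : ¬ j ≤ l)]
  have hJJ : ∀ i ∈ J, ∀ j ∈ J, i ≠ j → a {i, j} = m l * w i + m l * w j + q i j :=
    fun i hi j hj hij => by
      have h1 := (hmem.1 hi).1
      have h2 := (hmem.1 hj).1
      rw [ha2 i j hij]
      simp only [hG, if_neg (by omega : ¬ i ≤ l), if_neg (by omega : ¬ j ≤ l)]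
  have hdegJ : ∀ j ∈ J, ∑ i ∈ J.erase j, a {i, j} = m l + (n - 2) * m l * w j + d j := by
    intro j hj
    rw [Finset.sum_congr rfl fun i hi => hJJ i (Finset.mem_of_mem_erase hi) j hj
      (Finset.ne_of_mem_erase hi), Finset.sum_add_distrib, Finset.sum_add_distrib, hqdeg j hj,
      ← Finset.mul_sum, Finset.sum_erase_eq_sub hj, hw1, Finset.sum_const,
      Finset.card_erase_of_mem hj, nsmul_eq_mul, Nat.cast_sub (by omega), ← hnd, Nat.cast_one]
    ring
  have hlI : l ∈ I := Finset.mem_Icc.2 ⟨hl1, le_rfl⟩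
  have hmI : ∀ i ∈ I, 0 ≤ m i := fun i hi =>
    hmnn i (Finset.mem_Icc.1 hi).1 ((Finset.mem_Icc.1 hi).2.trans (by omega))
  refine ⟨a, fun j hj => ?_, fun i hi j hj => ?_, fun S hS => ?_, ?_, ?_, fun i hi => ?_,
    fun j hj => ?_, fun i₁ h₁ i₂ h₂ hlt j hj => ?_, fun i hi j hj hij => ?_⟩
  · rw [ha1]
    exact mul_nonneg (by linarith) (hw0 j hj)
  · rw [hIJ i hi j hj]
    exact mul_nonneg (hmI i hi) (hw0 j hj)
  · obtain ⟨hSJ, hcard⟩ := Finset.mem_filter.1 hS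
    obtain ⟨i, j, hij, rfl⟩ := Finset.card_eq_two.1 hcard
    rw [Finset.mem_powerset, Finset.insert_subset_iff, Finset.singleton_subset_iff] at hSJ
    rw [hJJ i hSJ.1 j hSJ.2 hij]
    exact add_nonneg (add_nonneg (mul_nonneg hl0 (hw0 i hSJ.1)) (mul_nonneg hl0 (hw0 j hSJ.2)))
      (hqnn i j)
  · rw [Finset.sum_congr rfl fun j _ => ha1 j, ← Finset.mul_sum, hw1]
    linarith
  · have h := sum_sum_powerset_filter_pair_mem J a
    rw [Finset.sum_congr rfl fun j hj => (sum_powerset_filter_pair_mem J a hj).trans (hdegJ j hj),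
      Finset.sum_add_distrib, Finset.sum_add_distrib, ← Finset.mul_sum, hw1, hdsum,
      Finset.sum_const, nsmul_eq_mul, ← hnd] at h
    linarith
  · rw [Finset.sum_congr rfl fun j hj => hIJ i hi j hj, ← Finset.mul_sum, hw1, mul_one]
  · have hjI : j ∉ I := Finset.disjoint_right.1 hdisj hj
    rw [sum_powerset_filter_pair_mem _ a (hunion ▸ Finset.mem_union_right I hj), hunion,
      Finset.erase_union_distrib, Finset.erase_eq_of_notMem hjI,
      Finset.sum_union (hdisj.mono_right (Finset.erase_subset _ _)), hdegJ j hj,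
      Finset.sum_congr rfl fun i hi => hIJ i hi j hj, ← Finset.sum_mul, ← hX, ha1]
    linarith [hw j hj]
  · rw [hIJ i₁ h₁ j hj, hIJ i₂ h₂ j hj]
    have hb₁ := Finset.mem_Icc.1 h₁
    have hb₂ := Finset.mem_Icc.1 h₂
    exact mul_le_mul_of_nonneg_right (hmle _ _ hb₁.1 hlt.le (by omega)) (hw0 j hj)
  · rw [hIJ l hlI i hi, hIJ l hlI j hj, hJJ i hi j hj hij]
    linarith [hqnn i j]
end

section
/- Let K ≥ 3 be an integer and l ∈ {1,…,K−2}. For each j ∈ {1,…,K}, define a probability distribution α^{(j)} on the orderings of {1,…,K}\{j} as follows: if j ≤ l, α^{(j)} assigns probability 1 to the increasing ordering (1,…,j−1,j+1,…,K); if j > l, α^{(j)} assigns probability 1/(K−l−1)! to each ordering of the form (1,2,…,l, x) where x is an ordering of {l+1,…,K}\{j}. Let S ⊆ {1,…,K} with 2 ≤ |S| ≤ K−1 and S ∩ {1,…,l} ≠ ∅, and define γ_S = min over j ∈ S of Σ_{i=1}^{K−|S|} Σ_{q} i·α^{(j)}(q), where the inner sum runs over orderings q = (q_1,…,q_{K−1})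 of {1,…,K}\{j} with q_{i+1} ∈ S and {q_1,…,q_i} ∩ S = ∅. Then γ_S = min(S) − 1, where min(S) denotes the least element of S. -/
open Classical

/-- The permutation weights used in the converse proof for the small total-memory
regime at heterogeneity level `l`: orderings of `{1,…,K} \ {j}` are encoded as
equivalences `q : Fin (K-1) ≃ {1,…,K} \ {j}` (zero-indexed).  If `j ≤ l`, weight `1`
on the increasing ordering `(1,…,j−1,j+1,…,K)`; if `j > l`, weight `1/(K−l−1)!` on each
ordering beginning with `(1,2,…,l)`. -/
noncomputable def alphaWeight (K l j : ℕ)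
    (q : Fin (K - 1) ≃ {x // x ∈ (Finset.Icc 1 K).erase j}) : ℝ :=
  if j ≤ l then
    (if ∀ a b : Fin (K - 1), a ≤ b → ((q a : ℕ) ≤ (q b : ℕ)) then 1 else 0)
  else
    (if ∀ a : Fin (K - 1), (a : ℕ) < l → ((q a : ℕ) = (a : ℕ) + 1) then
      1 / (Nat.factorial (K - l - 1) : ℝ)
    else 0)

open Finset in
theorem card_Icc_erase {K j : ℕ} (hj : j ∈ Icc 1 K) : ((Icc 1 K).erase j).card = K - 1 := by
  rw [card_erase_of_mem hj, Nat.card_Icc, Nat.add_sub_cancel]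

/-- The increasing ordering of `{1,…,K} \ {j}`. -/
noncomputable def increasingOrdering {K j : ℕ} (hj : j ∈ Finset.Icc 1 K) :
    Fin (K - 1) ≃ {x // x ∈ (Finset.Icc 1 K).erase j} :=
  (((Finset.Icc 1 K).erase j).orderIsoOfFin (card_Icc_erase hj)).toEquiv

theorem increasingOrdering_apply {K j : ℕ} (hj : j ∈ Finset.Icc 1 K) (a : Fin (K - 1)) :
    (increasingOrdering hj a : ℕ) = if (a : ℕ) + 1 < j then (a : ℕ) + 1 else (a : ℕ) + 2 := by
  have h := Finset.orderEmbOfFin_unique (card_Icc_erase hj)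
    (f := fun a : Fin (K - 1) => if (a : ℕ) + 1 < j then (a : ℕ) + 1 else (a : ℕ) + 2)
    (fun a => by
      have := a.2
      simp only [Finset.mem_erase, Finset.mem_Icc]
      split_ifs <;> omega)
    (fun a b hab => by
      have : (a : ℕ) < b := hab
      dsimp only
      split_ifs <;> omega)
  exact (congrFun h a).symm

theorem monotone_iff_eq_increasingOrdering {K j : ℕ} (hj : j ∈ Finset.Icc 1 K)
    (q : Fin (K - 1) ≃ {x // x ∈ (Finset.Icc 1 K).erase j}) :
    (∀ a b : Fin (K - 1), a ≤ b → (q a : ℕ) ≤ (q b : ℕ)) ↔ q = increasingOrdering hj := by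
  constructor
  · intro h
    have hmono : StrictMono fun a => (q a : ℕ) :=
      (show Monotone fun a => (q a : ℕ) from fun a b => h a b).strictMono_of_injective
        (Subtype.val_injective.comp q.injective)
    have := Finset.orderEmbOfFin_unique (card_Icc_erase hj) (fun a => (q a).2) hmono
    ext a
    exact congrFun this a
  · rintro rfl a b hab
    exact (((Finset.Icc 1 K).erase j).orderIsoOfFin (card_Icc_erase hj)).monotone hab

theorem card_orderings_with_prefix {K l j : ℕ} (hj : j ∈ Finset.Icc 1 K) (hlj : l < j) :
    (Finset.univ.filter fun q : Fin (K - 1) ≃ {x // x ∈ (Finset.Icc 1 K).erase j} =>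
      ∀ a : Fin (K - 1), (a : ℕ) < l → (q a : ℕ) = (a : ℕ) + 1).card =
      Nat.factorial (K - l - 1) := by
  have hpre : ∀ a : Fin (K - 1), (a : ℕ) < l → (increasingOrdering hj a : ℕ) = (a : ℕ) + 1 :=
    fun a ha => by rw [increasingOrdering_apply, if_pos (by omega)]
  let e : {q : Fin (K - 1) ≃ {x // x ∈ (Finset.Icc 1 K).erase j} //
      ∀ a : Fin (K - 1), (a : ℕ) < l → (q a : ℕ) = (a : ℕ) + 1} ≃
      {f : Equiv.Perm (Fin (K - 1)) // ∀ a : Fin (K - 1), ¬ l ≤ (a : ℕ) → f a = a} :=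
    ((Equiv.refl _).equivCongr (increasingOrdering hj).symm).subtypeEquiv fun q => by
      refine forall_congr' fun a => ?_
      rw [not_le]
      refine imp_congr_right fun ha => ?_
      rw [← hpre a ha, Subtype.val_inj]
      simp [Equiv.equivCongr, Equiv.symm_apply_eq]
  have hcard : Fintype.card {a : Fin (K - 1) // l ≤ (a : ℕ)} = K - l - 1 := by
    have hj' := Finset.mem_Icc.mp hj
    have h1 : Fintype.card {a : Fin (K - 1) // ¬ (a : ℕ) < l} = K - l - 1 := by
      rw [Fintype.card_subtype_compl, Fintype.card_fin, Fintype.card_subtype]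
      rw [Fin.card_filter_val_lt]
      omega
    simpa only [not_lt] using h1
  rw [← Fintype.card_subtype, Fintype.card_congr e,
    ← Fintype.card_congr (Equiv.Perm.subtypeEquivSubtypePerm fun a : Fin (K - 1) => l ≤ (a : ℕ)),
    Fintype.card_perm, hcard]

theorem alphaWeight_nonneg (K l j : ℕ)
    (q : Fin (K - 1) ≃ {x // x ∈ (Finset.Icc 1 K).erase j}) : 0 ≤ alphaWeight K l j q := by
  unfold alphaWeight
  split_ifs <;> positivity

theorem sum_alphaWeight {K j : ℕ} (l : ℕ) (hj : j ∈ Finset.Icc 1 K) :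
    ∑ q, alphaWeight K l j q = 1 := by
  unfold alphaWeight
  by_cases hjl : j ≤ l
  · simp only [if_pos hjl, monotone_iff_eq_increasingOrdering hj]
    simp
  · simp only [if_neg hjl]
    rw [← Finset.sum_filter, Finset.sum_const, card_orderings_with_prefix hj (not_le.mp hjl),
      nsmul_eq_mul, mul_one_div_cancel (by positivity)]

theorem apply_eq_of_alphaWeight_ne_zero {K l j : ℕ} (hj : j ∈ Finset.Icc 1 K)
    {q : Fin (K - 1) ≃ {x // x ∈ (Finset.Icc 1 K).erase j}} (hq : alphaWeight K l j q ≠ 0)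
    {a : Fin (K - 1)} (hal : (a : ℕ) < l) (haj : (a : ℕ) + 1 < j) : (q a : ℕ) = (a : ℕ) + 1 := by
  unfold alphaWeight at hq
  split_ifs at hq with h1 h2 h3
  · rw [(monotone_iff_eq_increasingOrdering hj q).mp h2, increasingOrdering_apply, if_pos haj]
  · exact absurd rfl hq
  · exact h3 a hal
  · exact absurd rfl hq

/-- The entry of `q` at position `i` (counted from zero) is the first one that lies in `S`. -/
def FirstHit {K j : ℕ} (S : Finset ℕ) (q : Fin (K - 1) ≃ {x // x ∈ (Finset.Icc 1 K).erase j})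
    (i : ℕ) : Prop :=
  (∀ a : Fin (K - 1), (a : ℕ) = i → ((q a : ℕ) ∈ S)) ∧
    (∀ a : Fin (K - 1), (a : ℕ) < i → ((q a : ℕ) ∉ S))

section FirstHit

variable {K j : ℕ} {S : Finset ℕ} {q : Fin (K - 1) ≃ {x // x ∈ (Finset.Icc 1 K).erase j}}

theorem exists_firstHit (hS : S ⊆ Finset.Icc 1 K) (h2 : 2 ≤ S.card) :
    ∃ i < K - 1, FirstHit S q i := by
  obtain ⟨s, hs, hsj⟩ := Finset.exists_mem_ne h2 j
  have hex : ∃ n, ∃ h : n < K - 1, (q ⟨n, h⟩ : ℕ) ∈ S := by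
    refine ⟨q.symm ⟨s, Finset.mem_erase.mpr ⟨hsj, hS hs⟩⟩, Fin.isLt _, ?_⟩
    simpa using hs
  obtain ⟨h, hmem⟩ := Nat.find_spec hex
  refine ⟨Nat.find hex, h, ?_, fun a ha hqa => Nat.find_min hex ha ⟨a.2, hqa⟩⟩
  rintro a ha
  rwa [show a = ⟨Nat.find hex, h⟩ from Fin.ext ha]

theorem FirstHit.eq {i i' : ℕ} (h : FirstHit S q i) (h' : FirstHit S q i') (hi : i < K - 1)
    (hi' : i' < K - 1) : i = i' := by
  rcases lt_trichotomy i i' with hlt | heq | hlt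
  · exact absurd (h.1 ⟨i, hi⟩ rfl) (h'.2 ⟨i, hi⟩ hlt)
  · exact heq
  · exact absurd (h'.1 ⟨i', hi'⟩ rfl) (h.2 ⟨i', hi'⟩ hlt)

theorem FirstHit.le {i : ℕ} (h : FirstHit S q i) (hi : i < K - 1) (hS : S ⊆ Finset.Icc 1 K) :
    i ≤ K - S.card := by
  have hcard : (Finset.Icc 1 K \ S).card = K - S.card := by
    rw [Finset.card_sdiff_of_subset hS, Nat.card_Icc, Nat.add_sub_cancel]
  rw [← hcard, ← Fintype.card_fin i, ← Finset.card_univ]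
  refine Finset.card_le_card_of_injOn (fun a : Fin i => (q ⟨a, a.2.trans hi⟩ : ℕ)) ?_ ?_
  · intro a _
    exact Finset.mem_coe.mpr (Finset.mem_sdiff.mpr
      ⟨Finset.mem_of_mem_erase (q ⟨a, a.2.trans hi⟩).2, h.2 _ a.2⟩)
  · intro a _ b _ hab
    have := q.injective (Subtype.val_injective hab)
    exact Fin.ext (Fin.mk.inj this)

theorem FirstHit.sum_eq {i : ℕ} (h : FirstHit S q i) (hi : i < K - 1)
    (hS : S ⊆ Finset.Icc 1 K) (h2 : 2 ≤ S.card) :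
    ∑ n ∈ Finset.Icc 1 (K - S.card), (if FirstHit S q n then (n : ℝ) else 0) = i := by
  rw [Finset.sum_eq_single i]
  · rw [if_pos h]
  · intro n hn hne
    have := Finset.mem_Icc.mp hn
    exact if_neg fun hn' => hne (hn'.eq h (by omega) hi)
  · intro hn
    have hle := h.le hi hS
    have : i = 0 := by
      by_contra h0
      exact hn (Finset.mem_Icc.mpr ⟨Nat.one_le_iff_ne_zero.mpr h0, hle⟩)
    simp [this]

end FirstHit

theorem sum_firstHit_eq_sum_weights (K l j : ℕ) (S : Finset ℕ) :
    ∑ i ∈ Finset.Icc 1 (K - S.card), (i : ℝ) *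
        ∑ q ∈ Finset.univ.filter
            (fun q : Fin (K - 1) ≃ {x // x ∈ (Finset.Icc 1 K).erase j} =>
              (∀ a : Fin (K - 1), (a : ℕ) = i → ((q a : ℕ) ∈ S)) ∧
              (∀ a : Fin (K - 1), (a : ℕ) < i → ((q a : ℕ) ∉ S))),
          alphaWeight K l j q =
      ∑ q, alphaWeight K l j q *
        ∑ i ∈ Finset.Icc 1 (K - S.card), (if FirstHit S q i then (i : ℝ) else 0) := by
  simp only [Finset.mul_sum]
  rw [Finset.sum_comm]
  refine Finset.sum_congr rfl fun i _ => ?_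
  rw [Finset.sum_filter]
  refine Finset.sum_congr rfl fun q _ => ?_
  unfold FirstHit
  split_ifs <;> ring

/-- for `S ⊆ {1,…,K}` with `2 ≤ |S| ≤ K−1` and `S ∩ {1,…,l} ≠ ∅`,
the coefficient `γ_S = min_{j ∈ S} Σ_{i=1}^{K−|S|} Σ_q i·α^{(j)}(q)` (inner sum over
orderings `q` of `{1,…,K}\{j}` with `q_{i+1} ∈ S` and `{q_1,…,q_i} ∩ S = ∅`) equals
`min(S) − 1`. -/
theorem stmt_10 (K : ℕ) (hK : 3 ≤ K) (l : ℕ) (hl1 : 1 ≤ l) (hlK : l ≤ K - 2)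
    (S : Finset ℕ) (hSsub : S ⊆ Finset.Icc 1 K)
    (hcard2 : 2 ≤ S.card) (hcardK : S.card ≤ K - 1)
    (hmeet : (S ∩ Finset.Icc 1 l).Nonempty) :
    S.inf' (Finset.card_pos.mp (by omega))
      (fun j => ∑ i ∈ Finset.Icc 1 (K - S.card), (i : ℝ) *
        ∑ q ∈ Finset.univ.filter
            (fun q : Fin (K - 1) ≃ {x // x ∈ (Finset.Icc 1 K).erase j} =>
              (∀ a : Fin (K - 1), (a : ℕ) = i → ((q a : ℕ) ∈ S)) ∧
              (∀ a : Fin (K - 1), (a : ℕ) < i → ((q a : ℕ) ∉ S))),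
          alphaWeight K l j q)
    = ((sInf (S : Set ℕ) : ℕ) : ℝ) - 1 := by
  have hne : S.Nonempty := Finset.card_pos.mp (by omega)
  set m := sInf (S : Set ℕ) with hm
  have hmS : m ∈ S := Nat.sInf_mem (s := (S : Set ℕ)) hne
  have hmin : ∀ s ∈ S, m ≤ s := fun s hs => Nat.sInf_le (s := (S : Set ℕ)) hs
  have hm1 : 1 ≤ m := (Finset.mem_Icc.mp (hSsub hmS)).1
  have hml : m ≤ l := by
    obtain ⟨s, hs⟩ := hmeet
    rw [Finset.mem_inter, Finset.mem_Icc] at hs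
    exact (hmin s hs.1).trans hs.2.2
  have hcast : ((m - 1 : ℕ) : ℝ) = (m : ℝ) - 1 := by push_cast [hm1]; ring
  have hconst : ∀ j ∈ S, ∑ q, alphaWeight K l j q * ((m - 1 : ℕ) : ℝ) = (m : ℝ) - 1 := by
    intro j hj
    rw [← Finset.sum_mul, sum_alphaWeight l (hSsub hj), one_mul, hcast]
  have hprefix : ∀ j ∈ S, ∀ q, alphaWeight K l j q ≠ 0 → ∀ a : Fin (K - 1),
      (a : ℕ) < m - 1 → (q a : ℕ) ∉ S := by
    intro j hj q hq a ha hqa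
    have hmj := hmin j hj
    have hqa' := hmin _ hqa
    rw [apply_eq_of_alphaWeight_ne_zero (hSsub hj) hq (by omega) (by omega)] at hqa'
    omega
  apply le_antisymm
  · obtain ⟨j, hj, hjm⟩ := Finset.exists_mem_ne (by omega : 1 < S.card) m
    have hmj : m < j := lt_of_le_of_ne (hmin j hj) hjm.symm
    refine (Finset.inf'_le _ hj).trans ?_
    rw [sum_firstHit_eq_sum_weights, ← hconst j hj]
    refine le_of_eq (Finset.sum_congr rfl fun q _ => ?_)
    by_cases hq : alphaWeight K l j q = 0
    · rw [hq, zero_mul, zero_mul]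
    have hhit : FirstHit S q (m - 1) := by
      refine ⟨fun a ha => ?_, hprefix j hj q hq⟩
      rw [apply_eq_of_alphaWeight_ne_zero (hSsub hj) hq (by omega) (by omega), ha,
        Nat.sub_add_cancel hm1]
      exact hmS
    rw [hhit.sum_eq (by omega) hSsub hcard2]
  · refine Finset.le_inf' _ _ fun j hj => ?_
    rw [sum_firstHit_eq_sum_weights, ← hconst j hj]
    refine Finset.sum_le_sum fun q _ => ?_
    by_cases hq : alphaWeight K l j q = 0
    · rw [hq, zero_mul, zero_mul]
    obtain ⟨i, hi, hhit⟩ := exists_firstHit (q := q) hSsub hcard2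
    rw [hhit.sum_eq hi hSsub hcard2]
    refine mul_le_mul_of_nonneg_left (Nat.cast_le.mpr ?_) (alphaWeight_nonneg K l j q)
    by_contra! hlt
    exact hprefix j hj q hq ⟨i, hi⟩ hlt (hhit.1 ⟨i, hi⟩ rfl)
end

section
/- Let K ≥ 3 be an integer, l ∈ {1,…,K−2}, and let m_1,…,m_K be nonnegative reals. For each nonempty S ⊆ {1,…,K} define the coefficient c_S as follows: c_S = K−1 if |S| = 1; c_S = (K + l(|S|−1) + |S|)/|S| if S ⊆ {l+1,…,K} and 2 ≤ |S| ≤ K−1; c_S = min(S) − 1 if S ∩ {1,…,l} ≠ ∅ and 2 ≤ |S| ≤ K−1; and c_S = 0 if S = {1,…,K}. Then for every fractional uncoded placement x for cache sizes m_1,…,m_K, Σ_S c_S · x_S ≥ (3K−l−2)/2 − Σ_{i=1}^{l} (K−i)·m_i − ((K−l)/2)·Σ_{i=l+1}^K m_i. -/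
/-- The coefficient `c_S` of STATEMENT 11: `K−1` if `|S| = 1`; `0` if `S = {1,…,K}`;
`(K + l(|S|−1) + |S|)/|S|` if `S ⊆ {l+1,…,K}` (and `2 ≤ |S| ≤ K−1`);
`min(S) − 1` if `S ∩ {1,…,l} ≠ ∅` (and `2 ≤ |S| ≤ K−1`). -/
noncomputable def lpCoef (K l : ℕ) (S : Finset ℕ) : ℝ :=
  if S.card = 1 then (K : ℝ) - 1
  else if S = Finset.Icc 1 K then 0
  else if S ⊆ Finset.Icc (l + 1) K then
    ((K : ℝ) + (l : ℝ) * ((S.card : ℝ) - 1) + (S.card : ℝ)) / (S.card : ℝ)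
  else ((sInf (S : Set ℕ) : ℕ) : ℝ) - 1

/-- The dual variable attached to the cache constraint of user `j`. -/
noncomputable def dualWeight (K l j : ℕ) : ℝ :=
  if j ≤ l then (K : ℝ) - j else ((K : ℝ) - l) / 2

lemma half_sub_le_dualWeight {K l : ℕ} (hl : l ≤ K) (j : ℕ) :
    ((K : ℝ) - l) / 2 ≤ dualWeight K l j := by
  have h : (l : ℝ) ≤ K := by exact_mod_cast hl
  unfold dualWeight
  split_ifs with hj
  · have : (j : ℝ) ≤ l := by exact_mod_cast hj
    linarith
  · exact le_rfl

lemma dualWeight_nonneg {K l : ℕ} (hl : l ≤ K) (j : ℕ) : 0 ≤ dualWeight K l j := by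
  have h : (l : ℝ) ≤ K := by exact_mod_cast hl
  linarith [half_sub_le_dualWeight hl j]

lemma le_sum_dualWeight {K l : ℕ} (hl : l ≤ K) {S : Finset ℕ} (hS : 1 < S.card) {a : ℕ}
    (ha : a ∈ S) (hal : a ≤ l) :
    (K : ℝ) - a + ((K : ℝ) - l) / 2 ≤ ∑ j ∈ S, dualWeight K l j := by
  obtain ⟨b, hb, hba⟩ := Finset.exists_mem_ne hS a
  calc (K : ℝ) - a + ((K : ℝ) - l) / 2 ≤ dualWeight K l a + dualWeight K l b := by
        gcongr
        · simp [dualWeight, hal]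
        · exact half_sub_le_dualWeight hl b
    _ = ∑ j ∈ {a, b}, dualWeight K l j := (Finset.sum_pair hba.symm).symm
    _ ≤ ∑ j ∈ S, dualWeight K l j :=
        Finset.sum_le_sum_of_subset_of_nonneg (by simp [Finset.insert_subset_iff, ha, hb])
          fun j _ _ => dualWeight_nonneg hl j

/-- Feasibility of the dual point: the dual constraint of every nonempty `S` holds. -/
lemma le_lpCoef_add_sum_dualWeight {K l : ℕ} (hl1 : 1 ≤ l) (hl : l ≤ K)
    {S : Finset ℕ} (hS : S ⊆ Finset.Icc 1 K) (hne : S.Nonempty) :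
    (3 * (K : ℝ) - l - 2) / 2 ≤ lpCoef K l S + ∑ j ∈ S, dualWeight K l j := by
  have hlR : (l : ℝ) ≤ K := by exact_mod_cast hl
  unfold lpCoef
  split_ifs with h1 h2 h3
  · obtain ⟨k, rfl⟩ := Finset.card_eq_one.mp h1
    rw [Finset.sum_singleton]
    linarith [half_sub_le_dualWeight hl k]
  · have hcard : 1 < S.card := by have := hne.card_pos; omega
    have h := le_sum_dualWeight hl hcard (a := 1) (by rw [h2, Finset.mem_Icc]; omega) hl1
    push_cast at h
    linarith
  · have hsum : ∑ j ∈ S, dualWeight K l j = S.card * (((K : ℝ) - l) / 2) := by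
      rw [← nsmul_eq_mul]
      refine Finset.sum_eq_card_nsmul fun j hj => ?_
      have := (Finset.mem_Icc.mp (h3 hj)).1
      exact if_neg (by omega)
    have hcard : (2 : ℝ) ≤ S.card := by
      have := hne.card_pos
      exact_mod_cast (show 2 ≤ S.card by omega)
    rw [hsum]
    generalize (S.card : ℝ) = s at hcard
    have key : ((K : ℝ) + l * (s - 1) + s) / s + s * (((K : ℝ) - l) / 2)
        - (3 * (K : ℝ) - l - 2) / 2
        = (((K : ℝ) - l) * ((s - 1) * (s - 2)) + 4 * s) / (2 * s) := by
      field_simp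
      ring
    have : 0 ≤ (((K : ℝ) - l) * ((s - 1) * (s - 2)) + 4 * s) / (2 * s) := by
      have := mul_nonneg (sub_nonneg.mpr hlR)
        (mul_nonneg (by linarith : 0 ≤ s - 1) (by linarith : 0 ≤ s - 2))
      exact div_nonneg (by linarith) (by linarith)
    linarith
  · have hcard : 1 < S.card := by have := hne.card_pos; omega
    have hmin : sInf (S : Set ℕ) ∈ S := by
      exact_mod_cast Nat.sInf_mem (s := (S : Set ℕ)) (by exact_mod_cast hne)
    obtain ⟨j, hj, hjl⟩ := Finset.not_subset.mp h3
    have hjK := (Finset.mem_Icc.mp (hS hj)).2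
    have hle : sInf (S : Set ℕ) ≤ j := Nat.sInf_le (by exact_mod_cast hj)
    rw [Finset.mem_Icc] at hjl
    have h := le_sum_dualWeight hl hcard hmin (by omega)
    linarith

lemma sum_dualWeight_mul {K l : ℕ} (hl : l ≤ K) (m : ℕ → ℝ) :
    ∑ i ∈ Finset.Icc 1 K, dualWeight K l i * m i =
      ∑ i ∈ Finset.Icc 1 l, ((K : ℝ) - i) * m i
        + (((K : ℝ) - l) / 2) * ∑ i ∈ Finset.Icc (l + 1) K, m i := by
  have hd : Disjoint (Finset.Icc 1 l) (Finset.Icc (l + 1) K) :=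
    Finset.disjoint_left.mpr fun i h h' => by
      rw [Finset.mem_Icc] at h h'
      omega
  have hu : Finset.Icc 1 K = Finset.Icc 1 l ∪ Finset.Icc (l + 1) K := by
    ext i
    simp only [Finset.mem_union, Finset.mem_Icc]
    omega
  rw [hu, Finset.sum_union hd, Finset.mul_sum]
  congr 1 <;> refine Finset.sum_congr rfl fun i hi => ?_ <;> rw [Finset.mem_Icc] at hi
  · rw [dualWeight, if_pos hi.2]
  · rw [dualWeight, if_neg (by omega)]

/-- Weighting the cache constraints of a placement by nonnegative multipliers. -/
lemma FracPlacement.sum_weight_mul_le {K : ℕ} {m : ℕ → ℝ} {x : Finset ℕ → ℝ}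
    (hx : FracPlacement K m x) {w : ℕ → ℝ} (hw : ∀ j, 0 ≤ w j) :
    ∑ S ∈ (Finset.Icc 1 K).powerset.erase ∅, (∑ j ∈ S, w j) * x S ≤
      ∑ j ∈ Finset.Icc 1 K, w j * m j := by
  calc ∑ S ∈ (Finset.Icc 1 K).powerset.erase ∅, (∑ j ∈ S, w j) * x S
      = ∑ S ∈ (Finset.Icc 1 K).powerset.erase ∅, ∑ j ∈ S, w j * x S := by
        simp only [Finset.sum_mul]
    _ = ∑ j ∈ Finset.Icc 1 K,
          ∑ S ∈ ((Finset.Icc 1 K).powerset.erase ∅).filter (fun S => j ∈ S), w j * x S := by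
        refine Finset.sum_comm' fun S j => ?_
        simp only [Finset.mem_filter, Finset.mem_erase, Finset.mem_powerset]
        exact ⟨fun h => ⟨h, h.1.2 h.2⟩, fun h => h.1⟩
    _ ≤ ∑ j ∈ Finset.Icc 1 K, w j * m j := by
        refine Finset.sum_le_sum fun j hj => ?_
        rw [← Finset.mul_sum]
        exact mul_le_mul_of_nonneg_left (hx.2.2 j hj) (hw j)

/-- the linear-programming converse
`Σ_S c_S·x_S ≥ (3K−l−2)/2 − Σ_{i=1}^l (K−i)m_i − ((K−l)/2)·Σ_{i=l+1}^K m_i`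
for every fractional uncoded placement `x`. -/
theorem stmt_11 (K : ℕ) (hK : 3 ≤ K) (l : ℕ) (hl1 : 1 ≤ l) (hlK : l ≤ K - 2)
    (m : ℕ → ℝ) (hm : ∀ k ∈ Finset.Icc 1 K, 0 ≤ m k)
    (x : Finset ℕ → ℝ) (hx : FracPlacement K m x) :
    ∑ S ∈ (Finset.Icc 1 K).powerset.erase ∅, lpCoef K l S * x S ≥
      (3 * (K : ℝ) - l - 2) / 2 - (∑ i ∈ Finset.Icc 1 l, ((K : ℝ) - i) * m i)
        - (((K : ℝ) - l) / 2) * (∑ i ∈ Finset.Icc (l + 1) K, m i) := by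
  have hl : l ≤ K := by omega
  have hfeas : (3 * (K : ℝ) - l - 2) / 2 ≤
      ∑ S ∈ (Finset.Icc 1 K).powerset.erase ∅,
        (lpCoef K l S + ∑ j ∈ S, dualWeight K l j) * x S := by
    rw [← mul_one ((3 * (K : ℝ) - l - 2) / 2), ← hx.2.1, Finset.mul_sum]
    refine Finset.sum_le_sum fun S hS => mul_le_mul_of_nonneg_right ?_ (hx.1 S hS)
    rw [Finset.mem_erase, Finset.mem_powerset] at hS
    exact le_lpCoef_add_sum_dualWeight hl1 hl hS.2 (Finset.nonempty_iff_ne_empty.mpr hS.1)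
  simp only [add_mul, Finset.sum_add_distrib] at hfeas
  have hcache := hx.sum_weight_mul_le (dualWeight_nonneg hl)
  rw [sum_dualWeight_mul hl] at hcache
  linarith
end

section
/- Let K ≥ 3 be an integer, l ∈ {1,…,K−2}, and let 0 ≤ m_1 ≤ ⋯ ≤ m_K ≤ 1 be reals with Σ_{k=1}^K m_k ≥ K−1, (K−l−1)·m_l < Σ_{i=l+1}^K m_i − 1, and (K−l−2)·m_{l+1} ≥ Σ_{i=l+2}^K m_i − 1. Define v_i = m_{i+1} − m_i for i ∈ {1,…,l−1}, v_l = (Σ_{j=l+1}^K m_j − 1 − (K−l−1)·m_l)/(K−l−1), and w_j = ((K−l−1)·m_j + 1 − Σ_{i=l+1}^K m_i)/(K−l−1) for j ∈ {l+1,…,K}. Then v_1,…,v_l and w_{l+1},…,w_K are all nonnegative, and Σ_{i=1}^{l} v_i + Σ_{j=l+1}^K w_j = 1 − m_1. -/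
/-- in the large total-memory regime at heterogeneity level `l`,
the multicast sizes `v_i = m_{i+1} − m_i` (for `i < l`),
`v_l = (Σ_{j>l} m_j − 1 − (K−l−1)m_l)/(K−l−1)` and
`w_j = ((K−l−1)m_j + 1 − Σ_{i>l} m_i)/(K−l−1)` (for `j > l`)
are all nonnegative and `Σ_{i=1}^l v_i + Σ_{j=l+1}^K w_j = 1 − m 1`. -/
theorem stmt_12 (K : ℕ) (hK : 3 ≤ K) (l : ℕ) (hl1 : 1 ≤ l) (hlK : l ≤ K - 2)
    (m : ℕ → ℝ) (hm0 : 0 ≤ m 1) (hm1 : m K ≤ 1)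
    (hmono : ∀ k ∈ Finset.Icc 1 (K - 1), m k ≤ m (k + 1))
    (hbig : (K : ℝ) - 1 ≤ ∑ k ∈ Finset.Icc 1 K, m k)
    (hstrict : ((K : ℝ) - l - 1) * m l < (∑ i ∈ Finset.Icc (l + 1) K, m i) - 1)
    (hge : ((K : ℝ) - l - 2) * m (l + 1) ≥ (∑ i ∈ Finset.Icc (l + 2) K, m i) - 1) :
    (∀ i ∈ Finset.Icc 1 (l - 1), 0 ≤ m (i + 1) - m i) ∧
    0 ≤ ((∑ j ∈ Finset.Icc (l + 1) K, m j) - 1 - ((K : ℝ) - l - 1) * m l)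
          / ((K : ℝ) - l - 1) ∧
    (∀ j ∈ Finset.Icc (l + 1) K,
      0 ≤ (((K : ℝ) - l - 1) * m j + 1 - ∑ i ∈ Finset.Icc (l + 1) K, m i)
            / ((K : ℝ) - l - 1)) ∧
    ((∑ i ∈ Finset.Icc 1 (l - 1), (m (i + 1) - m i))
      + ((∑ j ∈ Finset.Icc (l + 1) K, m j) - 1 - ((K : ℝ) - l - 1) * m l)
          / ((K : ℝ) - l - 1)
      + ∑ j ∈ Finset.Icc (l + 1) K,
          (((K : ℝ) - l - 1) * m j + 1 - ∑ i ∈ Finset.Icc (l + 1) K, m i)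
            / ((K : ℝ) - l - 1))
      = 1 - m 1 := by
  have hKl : l + 2 ≤ K := by omega
  have hD : (0 : ℝ) < (K : ℝ) - l - 1 := by
    have h : ((l + 2 : ℕ) : ℝ) ≤ K := Nat.cast_le.mpr hKl
    push_cast at h
    linarith
  have hsplit : ∑ i ∈ Finset.Icc (l + 1) K, m i
      = m (l + 1) + ∑ i ∈ Finset.Icc (l + 2) K, m i := by
    have h : l + 1 ≤ K := by omega
    rw [← Finset.add_sum_Ioc_eq_sum_Icc h, ← Finset.Icc_add_one_left_eq_Ioc,
      add_assoc l 1 1, one_add_one_eq_two]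
  have hle : ∀ j, l + 1 ≤ j → j ≤ K → m (l + 1) ≤ m j := by
    intro j hj
    induction j, hj using Nat.le_induction with
    | base => exact fun _ => le_rfl
    | succ k hk ih =>
      intro hkK
      exact (ih (by omega)).trans (hmono k (Finset.mem_Icc.mpr ⟨by omega, by omega⟩))
  have htel : ∑ i ∈ Finset.Icc 1 (l - 1), (m (i + 1) - m i) = m l - m 1 := by
    obtain ⟨n, rfl⟩ : ∃ n, l = n + 1 := ⟨l - 1, by omega⟩
    rw [← Finset.sum_Ico_sub m hl1]
    rfl
  refine ⟨fun i hi => ?_, div_nonneg (by linarith) hD.le, fun j hj => ?_, ?_⟩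
  · rw [Finset.mem_Icc] at hi
    exact sub_nonneg.mpr (hmono i (Finset.mem_Icc.mpr ⟨hi.1, by omega⟩))
  · rw [Finset.mem_Icc] at hj
    have h := mul_le_mul_of_nonneg_left (hle j hj.1 hj.2) hD.le
    exact div_nonneg (by linarith) hD.le
  · have hcard : (((Finset.Icc (l + 1) K).card : ℕ) : ℝ) = (K : ℝ) - l := by
      rw [Nat.card_Icc, Nat.add_sub_add_right, Nat.cast_sub (by omega)]
    rw [htel, ← Finset.sum_div, Finset.sum_sub_distrib, Finset.sum_add_distrib,
      ← Finset.mul_sum, Finset.sum_const, Finset.sum_const, nsmul_eq_mul, nsmul_eq_mul, hcard]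
    generalize ∑ i ∈ Finset.Icc (l + 1) K, m i = S
    field_simp
    ring
end

section
/- Let m_1 ≤ m_2 ≤ m_3 be nonnegative reals with 1 ≤ m_1+m_2+m_3 ≤ 2 and m_1 ≥ m_2+m_3−1. Then there exist nonnegative reals a_1, a_2, a_3, v_1, v_2, v_3 satisfying v_1+v_2+v_3 = (m_1+m_2+m_3−1)/2, a_1+v_1 = (m_1+1−m_2−m_3)/2, a_2+v_2 = (m_2+1−m_1−m_3)/2, and a_3+v_3 = (m_3+1−m_1−m_2)/2. Moreover, any reals a_1,a_2,a_3,v_1,v_2,v_3 satisfying these four equations satisfy 2(a_1+a_2+a_3) + (v_1+v_2+v_3) = 7/2 − (3/2)(m_1+m_2+m_3). -/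
/-- Region I of the three-user achievability proof.  There exist
nonnegative `a_1,a_2,a_3,v_1,v_2,v_3` solving the four placement equations, and every
solution of those equations has delivery load `2(a_1+a_2+a_3)+(v_1+v_2+v_3)
= 7/2 − (3/2)(m_1+m_2+m_3)`. -/
theorem stmt_13 (m1 m2 m3 : ℝ) (hm0 : 0 ≤ m1) (h12 : m1 ≤ m2) (h23 : m2 ≤ m3)
    (hlow : 1 ≤ m1 + m2 + m3) (hhigh : m1 + m2 + m3 ≤ 2)
    (hreg : m1 ≥ m2 + m3 - 1) :
    (∃ a1 a2 a3 v1 v2 v3 : ℝ,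
      0 ≤ a1 ∧ 0 ≤ a2 ∧ 0 ≤ a3 ∧ 0 ≤ v1 ∧ 0 ≤ v2 ∧ 0 ≤ v3 ∧
      v1 + v2 + v3 = (m1 + m2 + m3 - 1) / 2 ∧
      a1 + v1 = (m1 + 1 - m2 - m3) / 2 ∧
      a2 + v2 = (m2 + 1 - m1 - m3) / 2 ∧
      a3 + v3 = (m3 + 1 - m1 - m2) / 2) ∧
    (∀ a1 a2 a3 v1 v2 v3 : ℝ,
      v1 + v2 + v3 = (m1 + m2 + m3 - 1) / 2 →
      a1 + v1 = (m1 + 1 - m2 - m3) / 2 →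
      a2 + v2 = (m2 + 1 - m1 - m3) / 2 →
      a3 + v3 = (m3 + 1 - m1 - m2) / 2 →
      2 * (a1 + a2 + a3) + (v1 + v2 + v3) = 7 / 2 - (3 / 2) * (m1 + m2 + m3)) := by
  refine ⟨?_, fun a1 a2 a3 v1 v2 v3 hv h1 h2 h3 => by linarith⟩
  have hpos : 0 < 3 - (m1 + m2 + m3) := by linarith
  -- each user multicasts the same proportion `t` of its budget
  obtain ⟨t, ht⟩ : ∃ t, t = (m1 + m2 + m3 - 1) / (3 - (m1 + m2 + m3)) := ⟨_, rfl⟩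
  have ht0 : 0 ≤ t := ht ▸ div_nonneg (by linarith) hpos.le
  have ht1 : 0 ≤ 1 - t := by
    rw [ht, sub_nonneg, div_le_one hpos]
    linarith
  have hmul : t * (3 - (m1 + m2 + m3)) = m1 + m2 + m3 - 1 := by
    rw [ht, div_mul_cancel₀ _ hpos.ne']
  have hb1 : 0 ≤ (m1 + 1 - m2 - m3) / 2 := by linarith
  have hb2 : 0 ≤ (m2 + 1 - m1 - m3) / 2 := by linarith
  have hb3 : 0 ≤ (m3 + 1 - m1 - m2) / 2 := by linarith
  exact ⟨_, _, _, _, _, _, mul_nonneg ht1 hb1, mul_nonneg ht1 hb2, mul_nonneg ht1 hb3,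
    mul_nonneg ht0 hb1, mul_nonneg ht0 hb2, mul_nonneg ht0 hb3,
    by linear_combination hmul / 2, by ring, by ring, by ring⟩
end

section
/- Let m_1, m_2, m_3 be nonnegative reals and let x be a fractional uncoded placement for cache sizes m_1, m_2, m_3 (so x is indexed by the nonempty subsets of {1,2,3}). Then 2(x_{{1}} + x_{{2}} + x_{{3}}) + (1/2)(x_{{1,2}} + x_{{1,3}} + x_{{2,3}}) ≥ max{ 7/2 − (3/2)(m_1+m_2+m_3), 3/2 − (1/2)(m_1+m_2+m_3) }. -/
/-- The nonempty subsets of `{1, 2, 3}`, listed explicitly. -/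
theorem powerset_Icc_one_three_erase_empty :
    (Finset.Icc 1 3).powerset.erase (∅ : Finset ℕ) =
      {{1}, {2}, {3}, {1, 2}, {1, 3}, {2, 3}, {1, 2, 3}} := by
  decide

/-- three-user converse bound from the uniform permutation weights:
`2(x_{{1}}+x_{{2}}+x_{{3}}) + (1/2)(x_{{1,2}}+x_{{1,3}}+x_{{2,3}})
  ≥ max{7/2 − (3/2)(m_1+m_2+m_3), 3/2 − (1/2)(m_1+m_2+m_3)}`. -/
theorem stmt_17 (m : ℕ → ℝ) (hm : ∀ k ∈ Finset.Icc 1 3, 0 ≤ m k)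
    (x : Finset ℕ → ℝ) (hx : FracPlacement 3 m x) :
    2 * (x {1} + x {2} + x {3}) + (1 / 2) * (x {1, 2} + x {1, 3} + x {2, 3}) ≥
      max (7 / 2 - (3 / 2) * (m 1 + m 2 + m 3))
          (3 / 2 - (1 / 2) * (m 1 + m 2 + m 3)) := by
  obtain ⟨hnonneg, hsum, hcache⟩ := hx
  rw [powerset_Icc_one_three_erase_empty] at hnonneg hsum hcache
  have filter_one : Finset.filter (fun S : Finset ℕ => 1 ∈ S)
      {{1}, {2}, {3}, {1, 2}, {1, 3}, {2, 3}, {1, 2, 3}} =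
      {{1}, {1, 2}, {1, 3}, {1, 2, 3}} := by decide
  have filter_two : Finset.filter (fun S : Finset ℕ => 2 ∈ S)
      {{1}, {2}, {3}, {1, 2}, {1, 3}, {2, 3}, {1, 2, 3}} =
      {{2}, {1, 2}, {2, 3}, {1, 2, 3}} := by decide
  have filter_three : Finset.filter (fun S : Finset ℕ => 3 ∈ S)
      {{1}, {2}, {3}, {1, 2}, {1, 3}, {2, 3}, {1, 2, 3}} =
      {{3}, {1, 3}, {2, 3}, {1, 2, 3}} := by decide
  have h1 := hcache 1 (by decide)
  have h2 := hcache 2 (by decide)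
  have h3 := hcache 3 (by decide)
  rw [filter_one] at h1
  rw [filter_two] at h2
  rw [filter_three] at h3
  repeat rw [Finset.sum_insert (by decide)] at hsum
  repeat rw [Finset.sum_insert (by decide)] at h1
  repeat rw [Finset.sum_insert (by decide)] at h2
  repeat rw [Finset.sum_insert (by decide)] at h3
  rw [Finset.sum_singleton] at hsum h1 h2 h3
  have hx1 := hnonneg {1} (by decide)
  have hx2 := hnonneg {2} (by decide)
  have hx3 := hnonneg {3} (by decide)
  have hx123 := hnonneg {1, 2, 3} (by decide)
  exact max_le (by linarith) (by linarith)
end
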